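/- arXiv:1912.12472 — 5 statements merged into one kernel-verified Lean document; each statement's English description precedes it below -/
import Mathlib

section
/- Let α > 0, let f : [0,∞) → ℝ be measurable with ‖f‖_{L²_α} < ∞, let φ : [0,∞) → ℝ satisfy φ(x) = φ(0) + ∫₀^x f(y) dy for all x ≥ 0, and let ℓ := φ(0) + ∫₀^∞ f(y) dy be the limit of φ at infinity. Then for every p ∈ [1,∞) the function x ↦ φ(x) − ℓ belongs to L^p(0,∞), with ∫₀^∞ |φ(x) − ℓ|^p dx ≤ (2/(pα)) · (α^{-1/2} ‖f‖_{L²_α})^p. (H_α is continuously embedded in C_b([0,∞)) and in L^p(0,∞) ⊕ ℝ for every finite p.) -/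
open MeasureTheory Set Filter

/-- Membership of `f` in the weighted space, as `MemLp` of `|f| e^{αy/2}`. -/
lemma memLp_two_weighted {α : ℝ} {f : ℝ → ℝ} (hf : Measurable f)
    (hf2 : IntegrableOn (fun x => f x ^ 2 * Real.exp (α * x)) (Ioi 0)) :
    MemLp (fun y => |f y| * Real.exp (α / 2 * y)) 2 (volume.restrict (Ioi 0)) := by
  rw [memLp_two_iff_integrable_sq (by fun_prop)]
  refine hf2.congr (ae_of_all _ fun y => ?_)
  simp only [mul_pow, sq_abs, ← Real.exp_nat_mul]
  congr 2
  push_cast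
  ring

lemma memLp_two_exp_neg {α : ℝ} (hα : 0 < α) (x : ℝ) :
    MemLp (fun y => Real.exp (-(α / 2) * y)) 2 (volume.restrict (Ioi x)) := by
  rw [memLp_two_iff_integrable_sq (by fun_prop)]
  refine (integrableOn_exp_mul_Ioi (neg_lt_zero.2 hα) x).congr (ae_of_all _ fun y => ?_)
  simp only [← Real.exp_nat_mul]
  congr 1
  push_cast
  ring

lemma integrableOn_of_weighted {α : ℝ} (hα : 0 < α) {f : ℝ → ℝ} (hf : Measurable f)
    (hf2 : IntegrableOn (fun x => f x ^ 2 * Real.exp (α * x)) (Ioi 0)) :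
    IntegrableOn f (Ioi 0) := by
  refine ((memLp_two_weighted hf hf2).integrable_mul (memLp_two_exp_neg hα 0)).mono
    hf.aestronglyMeasurable (ae_of_all _ fun y => ?_)
  simp [mul_assoc, ← Real.exp_add]

/-- Cauchy–Schwarz bound for the tail of a function in a weighted `L²` space. -/
lemma abs_integral_Ioi_le {α : ℝ} (hα : 0 < α) {f : ℝ → ℝ} (hf : Measurable f)
    (hf2 : IntegrableOn (fun x => f x ^ 2 * Real.exp (α * x)) (Ioi 0)) {x : ℝ} (hx : 0 ≤ x) :
    |∫ y in Ioi x, f y| ≤ α ^ (-(1:ℝ)/2) *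
      (∫ y in Ioi (0:ℝ), f y ^ 2 * Real.exp (α * y)) ^ ((1:ℝ)/2) * Real.exp (-(α / 2) * x) := by
  have hsub : Ioi x ⊆ Ioi (0:ℝ) := Ioi_subset_Ioi hx
  have hF := (memLp_two_weighted hf hf2).mono_measure (Measure.restrict_mono_set volume hsub)
  have holder := integral_mul_le_Lp_mul_Lq_of_nonneg (μ := volume.restrict (Ioi x))
    Real.HolderConjugate.two_two
    (f := fun y => |f y| * Real.exp (α / 2 * y)) (g := fun y => Real.exp (-(α / 2) * y))
    (ae_of_all _ fun y => by positivity) (ae_of_all _ fun y => by positivity)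
    (by simpa using hF) (by simpa using memLp_two_exp_neg hα x)
  have e1 : ∀ y, |f y| * Real.exp (α / 2 * y) * Real.exp (-(α / 2) * y) = |f y| := fun y => by
    simp [mul_assoc, ← Real.exp_add]
  have e2 : ∀ y, (|f y| * Real.exp (α / 2 * y)) ^ (2:ℝ) = f y ^ 2 * Real.exp (α * y) := fun y => by
    rw [Real.rpow_two, mul_pow, sq_abs, ← Real.exp_nat_mul]
    congr 2
    push_cast
    ring
  have e3 : ∀ y, Real.exp (-(α / 2) * y) ^ (2:ℝ) = Real.exp (-α * y) := fun y => by
    rw [← Real.exp_mul]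
    congr 1
    ring
  simp only [e1, e2, e3] at holder
  have hexp : (∫ y in Ioi x, Real.exp (-α * y)) ^ ((1:ℝ)/2)
      = α ^ (-(1:ℝ)/2) * Real.exp (-(α / 2) * x) := by
    rw [integral_exp_mul_Ioi (neg_lt_zero.2 hα), neg_div_neg_eq,
      Real.div_rpow (Real.exp_pos _).le hα.le, ← Real.exp_mul, neg_div, Real.rpow_neg hα.le,
      div_eq_inv_mul]
    congr 2
    ring
  have hmono : ∫ y in Ioi x, f y ^ 2 * Real.exp (α * y)
      ≤ ∫ y in Ioi (0:ℝ), f y ^ 2 * Real.exp (α * y) :=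
    setIntegral_mono_set hf2 (ae_of_all _ fun y => by positivity) hsub.eventuallyLE
  calc |∫ y in Ioi x, f y| ≤ ∫ y in Ioi x, |f y| := abs_integral_le_integral_abs
    _ ≤ _ := holder
    _ ≤ (∫ y in Ioi (0:ℝ), f y ^ 2 * Real.exp (α * y)) ^ ((1:ℝ)/2) *
        (α ^ (-(1:ℝ)/2) * Real.exp (-(α / 2) * x)) := by
      rw [hexp]
      gcongr
    _ = _ := by ring

/-- If `α > 0`, `‖f‖_{L²_α} < ∞`, `φ(x) = φ(0) + ∫₀^x f` and `ℓ = φ(0) + ∫₀^∞ f` is the limit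
of `φ` at infinity, then for every `p ∈ [1,∞)` the function `x ↦ φ(x) − ℓ` belongs to
`L^p(0,∞)`, with `∫₀^∞ |φ − ℓ|^p ≤ (2/(pα)) (α^{-1/2} ‖f‖_{L²_α})^p`. -/
theorem stmt3 (α : ℝ) (hα : 0 < α) (f φ : ℝ → ℝ) (hf : Measurable f)
    (hf2 : MeasureTheory.IntegrableOn (fun x => f x ^ 2 * Real.exp (α * x)) (Set.Ioi 0))
    (hφ : ∀ x : ℝ, 0 ≤ x → φ x = φ 0 + ∫ y in (0:ℝ)..x, f y)
    (ℓ : ℝ) (hℓ : ℓ = φ 0 + ∫ y in Set.Ioi (0:ℝ), f y)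
    (p : ℝ) (hp : 1 ≤ p) :
    MeasureTheory.IntegrableOn (fun x => |φ x - ℓ| ^ p) (Set.Ioi 0) ∧
      (∫ x in Set.Ioi (0:ℝ), |φ x - ℓ| ^ p)
        ≤ (2 / (p * α)) *
          (α ^ (-(1:ℝ)/2) *
            (∫ y in Set.Ioi (0:ℝ), f y ^ 2 * Real.exp (α * y)) ^ ((1:ℝ)/2)) ^ p := by
  have hp0 : 0 < p := by linarith
  have hint := integrableOn_of_weighted hα hf hf2
  have hN : 0 ≤ ∫ y in Ioi (0:ℝ), f y ^ 2 * Real.exp (α * y) :=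
    integral_nonneg fun y => by positivity
  have htail : ∀ x, 0 ≤ x → φ x - ℓ = -∫ y in Ioi x, f y := fun x hx => by
    have := intervalIntegral.integral_interval_add_Ioi hint (hint.mono_set (Ioi_subset_Ioi hx))
    rw [hφ x hx, hℓ]
    linarith
  have hmeas : AEStronglyMeasurable (fun x => |φ x - ℓ| ^ p) (volume.restrict (Ioi 0)) := by
    have hcont : Continuous fun x => ∫ y in (0:ℝ)..x, (Ioi (0:ℝ)).indicator f y :=
      intervalIntegral.continuous_primitive
        (fun a b => (hint.integrable_indicator measurableSet_Ioi).intervalIntegrable) 0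
    have hm : Measurable fun x =>
        |φ 0 + (∫ y in (0:ℝ)..x, (Ioi (0:ℝ)).indicator f y) - ℓ| ^ p := by
      have := hcont.measurable
      fun_prop
    refine hm.aestronglyMeasurable.congr ?_
    filter_upwards [ae_restrict_mem measurableSet_Ioi] with x hx
    have hx0 : (0:ℝ) ≤ x := le_of_lt hx
    rw [hφ x hx0, intervalIntegral.integral_of_le hx0, intervalIntegral.integral_of_le hx0,
      setIntegral_congr_fun measurableSet_Ioc fun y hy => indicator_of_mem (mem_Ioi.2 hy.1) f]
  set C := α ^ (-(1:ℝ)/2) * (∫ y in Ioi (0:ℝ), f y ^ 2 * Real.exp (α * y)) ^ ((1:ℝ)/2) with hC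
  have hC0 : 0 ≤ C := by positivity
  have hneg : -(p * α / 2) < 0 := neg_lt_zero.2 (by positivity)
  have hbound : ∀ x ∈ Ioi (0:ℝ), |φ x - ℓ| ^ p ≤ C ^ p * Real.exp (-(p * α / 2) * x) := by
    intro x hx
    have hx0 : (0:ℝ) ≤ x := le_of_lt hx
    calc |φ x - ℓ| ^ p ≤ (C * Real.exp (-(α / 2) * x)) ^ p := by
          rw [htail x hx0, abs_neg]
          gcongr
          exact abs_integral_Ioi_le hα hf hf2 hx0
      _ = _ := by
          rw [Real.mul_rpow hC0 (Real.exp_pos _).le, ← Real.exp_mul]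
          congr 2
          ring
  have hdom : IntegrableOn (fun x => C ^ p * Real.exp (-(p * α / 2) * x)) (Ioi 0) :=
    (integrableOn_exp_mul_Ioi hneg 0).const_mul _
  have hI : IntegrableOn (fun x => |φ x - ℓ| ^ p) (Ioi 0) := by
    refine hdom.mono' hmeas ?_
    filter_upwards [ae_restrict_mem measurableSet_Ioi] with x hx
    rw [Real.norm_of_nonneg (by positivity)]
    exact hbound x hx
  refine ⟨hI, (setIntegral_mono_on hI hdom measurableSet_Ioi hbound).trans_eq ?_⟩
  rw [integral_const_mul, integral_exp_mul_Ioi hneg, mul_zero, Real.exp_zero]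
  field_simp
end

section
/- Let α > 0 and let (f_k)_{k≥1}, (g_k)_{k≥1} be sequences of measurable real-valued functions on [0,∞). Then ∫₀^∞ | Σ_{k=1}^∞ f_k(x) ∫₀^x g_k(y) dy |² e^{-αx} dx ≤ α^{-1} · ( ∫₀^∞ ( Σ_{k=1}^∞ f_k(x)² ) e^{αx} dx ) · ( Σ_{k=1}^∞ ∫₀^∞ g_k(y)² e^{-αy} dy ). In the notation of the paper: ‖⟨f, Ig⟩_{ℓ²}‖_{L²_{-α}} ≤ α^{-1/2} ‖f‖_{L²_α(ℓ²)} ‖g‖_{ℓ²(L²_{-α})}. -/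
open MeasureTheory Set Filter

/-- The Cauchy–Schwarz inequality for lower Lebesgue integrals, in squared form. -/
theorem lintegral_mul_sq_le {X : Type*} [MeasurableSpace X] {μ : Measure X} {u v : X → ENNReal}
    (hu : AEMeasurable u μ) (hv : AEMeasurable v μ) :
    (∫⁻ x, u x * v x ∂μ) ^ 2 ≤ (∫⁻ x, u x ^ 2 ∂μ) * ∫⁻ x, v x ^ 2 ∂μ := by
  have h := ENNReal.lintegral_mul_le_Lp_mul_Lq μ Real.HolderConjugate.two_two hu hv
  simp only [Pi.mul_apply, ENNReal.rpow_two] at h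
  have hsq (a : ENNReal) : (a ^ (1 / 2 : ℝ)) ^ 2 = a := by
    rw [← ENNReal.rpow_two, ← ENNReal.rpow_mul]
    norm_num
  calc (∫⁻ x, u x * v x ∂μ) ^ 2 ≤ _ := pow_le_pow_left' h 2
    _ = _ := by rw [mul_pow, hsq, hsq]

/-- The Cauchy–Schwarz inequality for series in `[0, ∞]`, in squared form. -/
theorem tsum_mul_sq_le (u v : ℕ → ENNReal) :
    (∑' k, u k * v k) ^ 2 ≤ (∑' k, u k ^ 2) * ∑' k, v k ^ 2 := by
  simpa only [lintegral_count] using lintegral_mul_sq_le (μ := Measure.count)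
    (measurable_of_countable u).aemeasurable (measurable_of_countable v).aemeasurable

theorem ofReal_sq_eq_enorm_sq (a : ℝ) : ENNReal.ofReal (a ^ 2) = ‖a‖ₑ ^ 2 := by
  rw [← sq_abs, ENNReal.ofReal_pow (abs_nonneg a), Real.enorm_eq_ofReal_abs]

theorem lintegral_Ioc_exp_mul_le {α : ℝ} (hα : 0 < α) {x : ℝ} (hx : 0 ≤ x) :
    ∫⁻ y in Ioc 0 x, ENNReal.ofReal (Real.exp (α * y)) ≤
      ENNReal.ofReal (α⁻¹ * Real.exp (α * x)) := by
  have hc : Continuous fun y : ℝ => Real.exp (α * y) := by fun_prop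
  rw [← ofReal_integral_eq_lintegral_ofReal
      (hc.intervalIntegrable 0 x).1
      (Eventually.of_forall fun y => (Real.exp_pos _).le),
    ← intervalIntegral.integral_of_le hx]
  apply ENNReal.ofReal_le_ofReal
  rw [intervalIntegral.integral_comp_mul_left (fun y => Real.exp y) hα.ne', integral_exp,
    smul_eq_mul]
  gcongr
  linarith [Real.exp_pos (α * 0)]

/-- The primitive of a function in `L²_{-α}` grows at most like `e^{αx/2}`. -/
theorem enorm_intervalIntegral_sq_le {α : ℝ} (hα : 0 < α) {g : ℝ → ℝ} (hg : Measurable g)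
    {x : ℝ} (hx : 0 ≤ x) :
    ‖∫ y in (0:ℝ)..x, g y‖ₑ ^ 2 ≤ ENNReal.ofReal (α⁻¹ * Real.exp (α * x)) *
      ∫⁻ y in Ioi (0:ℝ), ENNReal.ofReal (g y ^ 2 * Real.exp (-(α * y))) := by
  have hexp (t : ℝ) : ENNReal.ofReal (Real.exp (t / 2)) ^ 2 = ENNReal.ofReal (Real.exp t) := by
    rw [← ENNReal.ofReal_pow (Real.exp_pos _).le, ← Real.exp_nat_mul]
    congr 2
    push_cast
    ring
  rw [intervalIntegral.integral_of_le hx]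
  calc ‖∫ y in Ioc 0 x, g y‖ₑ ^ 2
      ≤ (∫⁻ y in Ioc 0 x, ‖g y‖ₑ) ^ 2 := pow_le_pow_left' (enorm_integral_le_lintegral_enorm _) 2
    _ = (∫⁻ y in Ioc 0 x, ENNReal.ofReal (Real.exp (α * y / 2)) *
          (‖g y‖ₑ * ENNReal.ofReal (Real.exp (-(α * y) / 2)))) ^ 2 := by
        congr 2 with y
        rw [mul_left_comm, ← ENNReal.ofReal_mul (Real.exp_pos _).le, ← Real.exp_add]
        simp [neg_div]
    _ ≤ (∫⁻ y in Ioc 0 x, ENNReal.ofReal (Real.exp (α * y / 2)) ^ 2) *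
          ∫⁻ y in Ioc 0 x, (‖g y‖ₑ * ENNReal.ofReal (Real.exp (-(α * y) / 2))) ^ 2 :=
        lintegral_mul_sq_le (by fun_prop) (by fun_prop)
    _ = (∫⁻ y in Ioc 0 x, ENNReal.ofReal (Real.exp (α * y))) *
          ∫⁻ y in Ioc 0 x, ENNReal.ofReal (g y ^ 2 * Real.exp (-(α * y))) := by
        simp only [mul_pow, hexp, ENNReal.ofReal_mul (sq_nonneg _), ofReal_sq_eq_enorm_sq]
    _ ≤ _ := mul_le_mul' (lintegral_Ioc_exp_mul_le hα hx)
        (lintegral_mono_set Ioc_subset_Ioi_self)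

/-- The key estimate `‖⟨f, Ig⟩_{ℓ²}‖_{L²_{-α}} ≤ α^{-1/2} ‖f‖_{L²_α(ℓ²)} ‖g‖_{ℓ²(L²_{-α})}`,
in squared form:
`∫₀^∞ |Σ_k f_k(x) ∫₀^x g_k|² e^{-αx} dx
  ≤ α⁻¹ (∫₀^∞ (Σ_k f_k(x)²) e^{αx} dx) (Σ_k ∫₀^∞ g_k² e^{-αy} dy)`. -/
theorem stmt10 (α : ℝ) (hα : 0 < α) (f g : ℕ → ℝ → ℝ)
    (hf : ∀ k, Measurable (f k)) (hg : ∀ k, Measurable (g k)) :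
    (∫⁻ x in Set.Ioi (0:ℝ),
        ENNReal.ofReal ((∑' k, f k x * ∫ y in (0:ℝ)..x, g k y) ^ 2 * Real.exp (-(α * x))))
      ≤ ENNReal.ofReal α⁻¹ *
        (∫⁻ x in Set.Ioi (0:ℝ),
          (∑' k, ENNReal.ofReal ((f k x) ^ 2)) * ENNReal.ofReal (Real.exp (α * x))) *
        (∑' k, ∫⁻ y in Set.Ioi (0:ℝ),
          ENNReal.ofReal ((g k y) ^ 2 * Real.exp (-(α * y)))) := by
  have hF : Measurable fun x =>
      (∑' k, ENNReal.ofReal ((f k x) ^ 2)) * ENNReal.ofReal (Real.exp (α * x)) :=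
    (Measurable.tsum fun k => ((hf k).pow_const 2).ennreal_ofReal).mul (by fun_prop)
  rw [← lintegral_const_mul _ hF, ← lintegral_mul_const _ (hF.const_mul _)]
  refine setLIntegral_mono ((hF.const_mul _).mul_const _) fun x hx => ?_
  have hx0 : (0:ℝ) ≤ x := le_of_lt hx
  set G := ∑' k, ∫⁻ y in Ioi (0:ℝ), ENNReal.ofReal (g k y ^ 2 * Real.exp (-(α * y))) with hG
  set F := ∑' k, ENNReal.ofReal (f k x ^ 2) with hFx
  have hsum : ‖∑' k, f k x * ∫ y in (0:ℝ)..x, g k y‖ₑ ^ 2 ≤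
      F * (ENNReal.ofReal (α⁻¹ * Real.exp (α * x)) * G) :=
    calc ‖∑' k, f k x * ∫ y in (0:ℝ)..x, g k y‖ₑ ^ 2
        ≤ (∑' k, ‖f k x‖ₑ * ‖∫ y in (0:ℝ)..x, g k y‖ₑ) ^ 2 := by
          simp only [← enorm_mul]
          exact pow_le_pow_left' enorm_tsum_le_tsum_enorm 2
      _ ≤ (∑' k, ‖f k x‖ₑ ^ 2) * ∑' k, ‖∫ y in (0:ℝ)..x, g k y‖ₑ ^ 2 := tsum_mul_sq_le _ _
      _ ≤ _ := by
          simp only [hFx, hG, ofReal_sq_eq_enorm_sq]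
          rw [← ENNReal.tsum_mul_left (a := ENNReal.ofReal (α⁻¹ * Real.exp (α * x)))]
          gcongr with k
          exact enorm_intervalIntegral_sq_le hα (hg k) hx0
  have hexp : ENNReal.ofReal (α⁻¹ * Real.exp (α * x)) * ENNReal.ofReal (Real.exp (-(α * x))) ≤
      ENNReal.ofReal α⁻¹ * ENNReal.ofReal (Real.exp (α * x)) := by
    rw [ENNReal.ofReal_mul (inv_pos.2 hα).le, mul_assoc]
    gcongr
    refine mul_le_of_le_one_right' (ENNReal.ofReal_le_one.2 (Real.exp_le_one_iff.2 ?_))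
    simpa using mul_nonneg hα.le hx0
  rw [ENNReal.ofReal_mul (sq_nonneg _), ofReal_sq_eq_enorm_sq]
  calc _ ≤ F * (ENNReal.ofReal (α⁻¹ * Real.exp (α * x)) * G) *
          ENNReal.ofReal (Real.exp (-(α * x))) := by gcongr
    _ = F * (ENNReal.ofReal (α⁻¹ * Real.exp (α * x)) *
          ENNReal.ofReal (Real.exp (-(α * x)))) * G := by ring
    _ ≤ F * (ENNReal.ofReal α⁻¹ * ENNReal.ofReal (Real.exp (α * x))) * G := by gcongr
    _ = _ := by ring
end

section
/- Let α > 0, ε > 0 and let ψ : [0,∞) → [0,∞) be measurable. Then the Hardy-type inequality ∫₀^∞ ( ∫_x^∞ ψ(y) dy )² e^{αx} dx ≤ ε^{-2} ∫₀^∞ ψ(y)² e^{(α+ε)y} dy holds. -/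
open MeasureTheory Set Filter

/-- The Cauchy-Schwarz inequality for the lower Lebesgue integral, in squared form. -/
theorem sq_lintegral_mul_le {X : Type*} [MeasurableSpace X] (μ : Measure X) {f g : X → ENNReal}
    (hf : AEMeasurable f μ) (hg : AEMeasurable g μ) :
    (∫⁻ x, f x * g x ∂μ) ^ 2 ≤ (∫⁻ x, f x ^ 2 ∂μ) * ∫⁻ x, g x ^ 2 ∂μ := by
  have h := ENNReal.lintegral_mul_le_Lp_mul_Lq μ Real.HolderConjugate.two_two hf hg
  simp only [Pi.mul_apply, ENNReal.rpow_two] at h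
  have hsqrt (a : ENNReal) : (a ^ (1 / 2 : ℝ)) ^ 2 = a := by
    rw [← ENNReal.rpow_two, ← ENNReal.rpow_mul]
    norm_num
  calc (∫⁻ x, f x * g x ∂μ) ^ 2 ≤ _ := pow_le_pow_left' h 2
    _ = _ := by rw [mul_pow, hsqrt, hsqrt]

theorem lintegral_exp_neg_mul_Ioi {b : ℝ} (hb : 0 < b) (c : ℝ) :
    ∫⁻ y in Ioi c, ENNReal.ofReal (Real.exp (-b * y)) = ENNReal.ofReal (Real.exp (-b * c) / b) := by
  rw [← ofReal_integral_eq_lintegral_ofReal (integrableOn_exp_mul_Ioi (neg_lt_zero.2 hb) c)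
    (Eventually.of_forall fun _ => (Real.exp_pos _).le),
    integral_exp_mul_Ioi (neg_lt_zero.2 hb), neg_div_neg_eq]

/-- A tail integral is controlled by the exponentially weighted square integral of the tail. -/
theorem sq_lintegral_Ioi_le {b : ℝ} (hb : 0 < b) {ψ : ℝ → ℝ} (hψ : Measurable ψ)
    (hψ0 : ∀ x, 0 ≤ ψ x) (x : ℝ) :
    (∫⁻ y in Ioi x, ENNReal.ofReal (ψ y)) ^ 2 ≤
      (∫⁻ y in Ioi x, ENNReal.ofReal (ψ y ^ 2 * Real.exp (b * y))) *
        ENNReal.ofReal (Real.exp (-b * x) / b) := by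
  have h := sq_lintegral_mul_le (volume.restrict (Ioi x))
    (f := fun y => ENNReal.ofReal (ψ y * Real.exp (b * y / 2)))
    (g := fun y => ENNReal.ofReal (Real.exp (-b * y / 2)))
    (by fun_prop) (by fun_prop)
  rw [← lintegral_exp_neg_mul_Ioi hb]
  convert h using 5 with y y y
  · rw [← ENNReal.ofReal_mul (mul_nonneg (hψ0 y) (Real.exp_pos _).le), mul_assoc, ← Real.exp_add]
    ring_nf
    simp
  · rw [← ENNReal.ofReal_pow (mul_nonneg (hψ0 y) (Real.exp_pos _).le), mul_pow, ← Real.exp_nat_mul]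
    ring_nf
  · rw [← ENNReal.ofReal_pow (Real.exp_pos _).le, ← Real.exp_nat_mul]
    ring_nf

/-- Hardy-type inequality (in `[0,∞]`): for `α, ε > 0` and measurable `ψ : [0,∞) → [0,∞)`,
`∫₀^∞ (∫_x^∞ ψ)² e^{αx} dx ≤ ε⁻² ∫₀^∞ ψ(y)² e^{(α+ε)y} dy`. -/
theorem stmt13 (α ε : ℝ) (hα : 0 < α) (hε : 0 < ε)
    (ψ : ℝ → ℝ) (hψ : Measurable ψ) (hψ0 : ∀ x, 0 ≤ ψ x) :
    (∫⁻ x in Set.Ioi (0:ℝ),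
        (∫⁻ y in Set.Ioi x, ENNReal.ofReal (ψ y)) ^ 2 * ENNReal.ofReal (Real.exp (α * x)))
      ≤ ENNReal.ofReal (ε ^ 2)⁻¹ *
          ∫⁻ y in Set.Ioi (0:ℝ), ENNReal.ofReal ((ψ y) ^ 2 * Real.exp ((α + ε) * y)) := by
  have hb : 0 < α + ε := add_pos hα hε
  set I := ∫⁻ y in Ioi (0:ℝ), ENNReal.ofReal ((ψ y) ^ 2 * Real.exp ((α + ε) * y))
  have key : ∀ x ∈ Ioi (0:ℝ),
      (∫⁻ y in Ioi x, ENNReal.ofReal (ψ y)) ^ 2 * ENNReal.ofReal (Real.exp (α * x)) ≤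
        I * ENNReal.ofReal (α + ε)⁻¹ * ENNReal.ofReal (Real.exp (-ε * x)) := by
    intro x hx
    calc _ ≤ I * ENNReal.ofReal (Real.exp (-(α + ε) * x) / (α + ε)) *
          ENNReal.ofReal (Real.exp (α * x)) := by
          gcongr
          refine (sq_lintegral_Ioi_le hb hψ hψ0 x).trans ?_
          gcongr
          exact lintegral_mono_set (Ioi_subset_Ioi (mem_Ioi.1 hx).le)
      _ = _ := by
          rw [mul_assoc, mul_assoc, ← ENNReal.ofReal_mul (by positivity),
            ← ENNReal.ofReal_mul (by positivity), div_mul_eq_mul_div, ← Real.exp_add,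
            div_eq_inv_mul]
          ring_nf
  refine (setLIntegral_mono (by fun_prop) key).trans ?_
  rw [lintegral_const_mul _ (by fun_prop), lintegral_exp_neg_mul_Ioi hε, mul_assoc, mul_comm,
    ← ENNReal.ofReal_mul (by positivity)]
  gcongr
  rw [mul_zero, Real.exp_zero, one_div, sq, mul_inv]
  gcongr
  linarith
end

section
/- Let α > 0 and let ψ = (ψ_k)_{k≥1} be a sequence of nonnegative measurable functions with ‖ψ‖_{ℓ²(L²_α)} < ∞. For n ∈ ℕ let χ_n : [0,∞) → [0,1] be differentiable with χ_n = 1 on [0,n], χ_n = 0 on [n+1,∞), and |χ_n'| ≤ 2, and define ψ_k^{(n)}(x) := χ_n(x) ∫_x^∞ ψ_k(y) dy and ψ̄_k^{(n)}(x) := χ_n'(x) ∫_x^∞ ψ_k(y) dy. Then ψ^{(n)} = (ψ_k^{(n)}) and ψ̄^{(n)} = (ψ̄_k^{(n)}) belong to ℓ²(L²_α) for every n, with ‖ψ^{(n)}‖_{ℓ²(L²_α)} ≤ α^{-1/2} √(n+1) ‖ψ‖_{ℓ²(L²_α)} and ‖ψ̄^{(n)}‖_{ℓ²(L²_α)} ≤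 2 α^{-1/2} ‖𝟙_{[n,∞)} ψ‖_{ℓ²(L²_α)}; in particular ‖ψ̄^{(n)}‖_{ℓ²(L²_α)} → 0 as n → ∞. -/
open MeasureTheory Set Filter

/-- Weighted Cauchy–Schwarz bound for the tail integral of a nonnegative function. -/
theorem ofReal_sq_tail_mul_exp_le {α : ℝ} (hα : 0 < α) {f : ℝ → ℝ} (hf : Measurable f)
    (hf0 : ∀ x, 0 ≤ f x) (x : ℝ) :
    ENNReal.ofReal ((∫ y in Ioi x, f y) ^ 2 * Real.exp (α * x)) ≤
      ENNReal.ofReal α⁻¹ * ∫⁻ y in Ioi x, ENNReal.ofReal (f y ^ 2 * Real.exp (α * y)) := by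
  have hexp : ∫⁻ y in Ioi x, ENNReal.ofReal (Real.exp (-α * y)) =
      ENNReal.ofReal (α⁻¹ * Real.exp (-(α * x))) := by
    rw [← ofReal_integral_eq_lintegral_ofReal (integrableOn_exp_mul_Ioi (by linarith) x)
      (ae_of_all _ fun y => (Real.exp_pos _).le), integral_exp_mul_Ioi (by linarith) x]
    congr 1
    rw [neg_mul]
    field_simp
  have hint : ENNReal.ofReal (∫ y in Ioi x, f y) ≤ ∫⁻ y in Ioi x, ENNReal.ofReal (f y) := by
    rw [integral_eq_lintegral_of_nonneg_ae (ae_of_all _ hf0) hf.aestronglyMeasurable]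
    exact ENNReal.ofReal_toReal_le
  have hCS : (∫⁻ y in Ioi x, ENNReal.ofReal (f y)) ^ 2 ≤
      (∫⁻ y in Ioi x, ENNReal.ofReal (f y ^ 2 * Real.exp (α * y))) *
        ENNReal.ofReal (α⁻¹ * Real.exp (-(α * x))) := by
    have h := ENNReal.lintegral_mul_le_Lp_mul_Lq (volume.restrict (Ioi x))
      Real.HolderConjugate.two_two
      (f := fun y => ENNReal.ofReal (f y * Real.exp (α * y / 2)))
      (g := fun y => ENNReal.ofReal (Real.exp (-(α * y) / 2)))
      (by fun_prop) (by fun_prop)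
    have h1 : ∀ y, ENNReal.ofReal (f y * Real.exp (α * y / 2)) *
        ENNReal.ofReal (Real.exp (-(α * y) / 2)) = ENNReal.ofReal (f y) := fun y => by
      rw [← ENNReal.ofReal_mul (mul_nonneg (hf0 y) (Real.exp_pos _).le), mul_assoc,
        ← Real.exp_add]
      ring_nf
      simp
    have h2 : ∀ y, ENNReal.ofReal (f y * Real.exp (α * y / 2)) ^ (2 : ℝ) =
        ENNReal.ofReal (f y ^ 2 * Real.exp (α * y)) := fun y => by
      rw [ENNReal.rpow_two, ← ENNReal.ofReal_pow (mul_nonneg (hf0 y) (Real.exp_pos _).le),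
        mul_pow, ← Real.exp_nat_mul]
      congr 3
      push_cast
      ring
    have h3 : ∀ y, ENNReal.ofReal (Real.exp (-(α * y) / 2)) ^ (2 : ℝ) =
        ENNReal.ofReal (Real.exp (-α * y)) := fun y => by
      rw [ENNReal.rpow_two, ← ENNReal.ofReal_pow (Real.exp_pos _).le, ← Real.exp_nat_mul]
      congr 2
      push_cast
      ring
    simp only [Pi.mul_apply, h1, h2, h3, hexp] at h
    refine (pow_le_pow_left₀ zero_le h 2).trans_eq ?_
    rw [mul_pow, ← ENNReal.rpow_two, ← ENNReal.rpow_two, ← ENNReal.rpow_mul, ← ENNReal.rpow_mul]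
    norm_num
  calc ENNReal.ofReal ((∫ y in Ioi x, f y) ^ 2 * Real.exp (α * x))
      = ENNReal.ofReal (∫ y in Ioi x, f y) ^ 2 * ENNReal.ofReal (Real.exp (α * x)) := by
        rw [ENNReal.ofReal_mul (sq_nonneg _),
          ENNReal.ofReal_pow (integral_nonneg fun y => hf0 y)]
    _ ≤ ((∫⁻ y in Ioi x, ENNReal.ofReal (f y ^ 2 * Real.exp (α * y))) *
          ENNReal.ofReal (α⁻¹ * Real.exp (-(α * x)))) * ENNReal.ofReal (Real.exp (α * x)) := by
        gcongr
        exact (pow_le_pow_left₀ zero_le hint 2).trans hCS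
    _ = _ := by
        rw [mul_assoc, ← ENNReal.ofReal_mul (by positivity), mul_assoc, ← Real.exp_add]
        simp [mul_comm]

/-- A bounded multiplier supported in `[a, b]` maps tail integrals into the weighted `L²` space. -/
theorem lintegral_mul_tail_le {α : ℝ} (hα : 0 < α) {f : ℝ → ℝ} (hf : Measurable f)
    (hf0 : ∀ x, 0 ≤ f x) {g : ℝ → ℝ} {a b c : ℝ} (ha : 0 ≤ a)
    (hgc : ∀ x, |g x| ≤ c) (hga : ∀ x, 0 < x → x < a → g x = 0) (hgb : ∀ x, b < x → g x = 0) :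
    ∫⁻ x in Ioi (0 : ℝ), ENNReal.ofReal ((g x * ∫ y in Ioi x, f y) ^ 2 * Real.exp (α * x)) ≤
      ENNReal.ofReal (c ^ 2 * α⁻¹ * (b - a)) * ∫⁻ x in Ioi (0 : ℝ),
        ENNReal.ofReal ((Ici a).indicator f x ^ 2 * Real.exp (α * x)) := by
  set J := ∫⁻ x in Ioi (0 : ℝ), ENNReal.ofReal ((Ici a).indicator f x ^ 2 * Real.exp (α * x))
    with hJ
  have htail : ∀ x, a ≤ x →
      ∫⁻ y in Ioi x, ENNReal.ofReal (f y ^ 2 * Real.exp (α * y)) ≤ J := fun x hx => by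
    rw [hJ, setLIntegral_congr_fun (g := fun y => ENNReal.ofReal
      ((Ici a).indicator f y ^ 2 * Real.exp (α * y))) measurableSet_Ioi fun y hy => by
        simp only [indicator_of_mem (show y ∈ Ici a from hx.trans (le_of_lt hy))]]
    exact lintegral_mono_set (Ioi_subset_Ioi (ha.trans hx))
  have hpt : ∀ x ∈ Ioi (0 : ℝ),
      ENNReal.ofReal ((g x * ∫ y in Ioi x, f y) ^ 2 * Real.exp (α * x)) ≤
        (Icc a b).indicator (fun _ => ENNReal.ofReal (c ^ 2 * α⁻¹) * J) x := fun x hx => by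
    by_cases hxm : x ∈ Icc a b
    · rw [indicator_of_mem hxm, mul_pow, mul_assoc, ENNReal.ofReal_mul (sq_nonneg _),
        ENNReal.ofReal_mul (sq_nonneg c), mul_assoc]
      refine mul_le_mul' (ENNReal.ofReal_le_ofReal ?_) ?_
      · exact sq_le_sq' (neg_le_of_abs_le (hgc x)) (le_of_abs_le (hgc x))
      · exact (ofReal_sq_tail_mul_exp_le hα hf hf0 x).trans (by gcongr; exact htail x hxm.1)
    · have : g x = 0 := by
        by_cases h : x < a
        · exact hga x hx h
        · exact hgb x (lt_of_not_ge fun h' => hxm ⟨not_lt.1 h, h'⟩)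
      simp [this]
  calc _ ≤ ∫⁻ x in Ioi (0 : ℝ),
        (Icc a b).indicator (fun _ => ENNReal.ofReal (c ^ 2 * α⁻¹) * J) x :=
        setLIntegral_mono' measurableSet_Ioi hpt
    _ ≤ ∫⁻ x, (Icc a b).indicator (fun _ => ENNReal.ofReal (c ^ 2 * α⁻¹) * J) x :=
        setLIntegral_le_lintegral _ _
    _ = _ := by
        rw [lintegral_indicator_const measurableSet_Icc, Real.volume_Icc,
          ENNReal.ofReal_mul (p := c ^ 2 * α⁻¹) (by positivity)]
        ring

/-- If the sum of the `p k` is bounded termwise by `D ^ 2` times `q k`, its square root is bounded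
by `D` times the square root of the sum of the `q k`. -/
theorem tsum_rpow_half_le_of_le_sq {p q : ℕ → ENNReal} {C D : ℝ} (hD : 0 ≤ D) (hCD : C = D ^ 2)
    (h : ∀ k, p k ≤ ENNReal.ofReal C * q k) :
    (∑' k, p k) ^ ((1 : ℝ) / 2) ≤ ENNReal.ofReal D * (∑' k, q k) ^ ((1 : ℝ) / 2) := by
  calc (∑' k, p k) ^ ((1 : ℝ) / 2) ≤ (ENNReal.ofReal C * ∑' k, q k) ^ ((1 : ℝ) / 2) := by
        rw [← ENNReal.tsum_mul_left]
        exact ENNReal.rpow_le_rpow (ENNReal.tsum_le_tsum h) (by norm_num)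
    _ = _ := by
        rw [ENNReal.mul_rpow_of_nonneg _ _ (by norm_num), hCD, ENNReal.ofReal_pow hD,
          ← ENNReal.rpow_two, ← ENNReal.rpow_mul]
        norm_num

/-- The tails `𝟙_{[n,∞)} ψ` of a sequence in `ℓ²(L²_α)` tend to zero. -/
theorem tendsto_tsum_lintegral_indicator_Ici {α : ℝ} {ψ : ℕ → ℝ → ℝ}
    (hψm : ∀ k, Measurable (ψ k))
    (hψfin : (∑' k, ∫⁻ x in Ioi (0 : ℝ),
      ENNReal.ofReal (ψ k x ^ 2 * Real.exp (α * x))) < ⊤) :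
    Tendsto (fun n : ℕ => ∑' k, ∫⁻ x in Ioi (0 : ℝ),
      ENNReal.ofReal ((Ici (n : ℝ)).indicator (ψ k) x ^ 2 * Real.exp (α * x)))
      atTop (nhds 0) := by
  have hm : ∀ k, Measurable fun x => ENNReal.ofReal (ψ k x ^ 2 * Real.exp (α * x)) := fun k => by
    have := hψm k
    fun_prop
  have hmi : ∀ (n : ℕ) k, Measurable fun x =>
      ENNReal.ofReal ((Ici (n : ℝ)).indicator (ψ k) x ^ 2 * Real.exp (α * x)) := fun n k => by
    have := (hψm k).indicator (measurableSet_Ici (a := (n : ℝ)))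
    fun_prop
  rw [← lintegral_tsum fun k => (hm k).aemeasurable] at hψfin
  simp_rw [← lintegral_tsum fun k => (hmi _ k).aemeasurable]
  rw [← lintegral_zero (μ := volume.restrict (Ioi (0 : ℝ)))]
  refine tendsto_lintegral_of_dominated_convergence _
    (fun n => Measurable.tsum (hmi n)) (fun n => ae_of_all _ fun x => ?_) hψfin.ne
    (ae_of_all _ fun x => ?_)
  · refine ENNReal.tsum_le_tsum fun k => ?_
    by_cases hx : x ∈ Ici (n : ℝ) <;> simp [hx]
  · obtain ⟨N, hN⟩ := exists_nat_gt x
    refine tendsto_const_nhds.congr' ?_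
    filter_upwards [eventually_ge_atTop N] with n hn
    have hx : x ∉ Ici (n : ℝ) := not_le.2 (hN.trans_le (by exact_mod_cast hn))
    simp [hx]

/-- Cut-off approximations: with `ψ_k^{(n)}(x) = χ_n(x) ∫_x^∞ ψ_k` and
`ψ̄_k^{(n)}(x) = χ_n'(x) ∫_x^∞ ψ_k`, one has
`‖ψ^{(n)}‖_{ℓ²(L²_α)} ≤ α^{-1/2} √(n+1) ‖ψ‖_{ℓ²(L²_α)}`,
`‖ψ̄^{(n)}‖_{ℓ²(L²_α)} ≤ 2 α^{-1/2} ‖𝟙_{[n,∞)} ψ‖_{ℓ²(L²_α)}`, and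
`‖ψ̄^{(n)}‖_{ℓ²(L²_α)} → 0` as `n → ∞`. -/
theorem stmt15 (α : ℝ) (hα : 0 < α) (ψ : ℕ → ℝ → ℝ)
    (hψm : ∀ k, Measurable (ψ k)) (hψ0 : ∀ k x, 0 ≤ ψ k x)
    (hψfin : (∑' k, ∫⁻ x in Set.Ioi (0:ℝ),
        ENNReal.ofReal ((ψ k x) ^ 2 * Real.exp (α * x))) < ⊤)
    (χ : ℕ → ℝ → ℝ) (χd : ℕ → ℝ → ℝ)
    (hχd : ∀ n x, HasDerivAt (χ n) (χd n x) x)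
    (hχ01 : ∀ n x, 0 ≤ χ n x ∧ χ n x ≤ 1)
    (hχ1 : ∀ n : ℕ, ∀ x : ℝ, 0 ≤ x → x ≤ (n : ℝ) → χ n x = 1)
    (hχ0 : ∀ n : ℕ, ∀ x : ℝ, (n : ℝ) + 1 ≤ x → χ n x = 0)
    (hχd2 : ∀ n x, |χd n x| ≤ 2) :
    (∀ n : ℕ,
      (∑' k, ∫⁻ x in Set.Ioi (0:ℝ),
          ENNReal.ofReal ((χ n x * ∫ y in Set.Ioi x, ψ k y) ^ 2 *
            Real.exp (α * x))) ^ ((1:ℝ)/2)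
        ≤ ENNReal.ofReal (α ^ (-(1:ℝ)/2) * Real.sqrt ((n : ℝ) + 1)) *
            (∑' k, ∫⁻ x in Set.Ioi (0:ℝ),
              ENNReal.ofReal ((ψ k x) ^ 2 * Real.exp (α * x))) ^ ((1:ℝ)/2)) ∧
    (∀ n : ℕ,
      (∑' k, ∫⁻ x in Set.Ioi (0:ℝ),
          ENNReal.ofReal ((χd n x * ∫ y in Set.Ioi x, ψ k y) ^ 2 *
            Real.exp (α * x))) ^ ((1:ℝ)/2)
        ≤ ENNReal.ofReal (2 * α ^ (-(1:ℝ)/2)) *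
            (∑' k, ∫⁻ x in Set.Ioi (0:ℝ),
              ENNReal.ofReal ((Set.indicator (Set.Ici (n : ℝ)) (ψ k) x) ^ 2 *
                Real.exp (α * x))) ^ ((1:ℝ)/2)) ∧
    Filter.Tendsto
      (fun n : ℕ =>
        (∑' k, ∫⁻ x in Set.Ioi (0:ℝ),
          ENNReal.ofReal ((χd n x * ∫ y in Set.Ioi x, ψ k y) ^ 2 *
            Real.exp (α * x))) ^ ((1:ℝ)/2))
      Filter.atTop (nhds 0) := by
  have hα2 : (α ^ (-(1:ℝ)/2)) ^ 2 = α⁻¹ := by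
    rw [← Real.rpow_natCast, ← Real.rpow_mul hα.le, ← Real.rpow_neg_one]
    norm_num
  have hχd_left : ∀ (n : ℕ) x, 0 < x → x < (n : ℝ) → χd n x = 0 := fun n x hx0 hxn =>
    (hχd n x).unique <| (hasDerivAt_const x (1 : ℝ)).congr_of_eventuallyEq <| by
      filter_upwards [Ioo_mem_nhds hx0 hxn] with y hy using hχ1 n y hy.1.le hy.2.le
  have hχd_right : ∀ (n : ℕ) x, (n : ℝ) + 1 < x → χd n x = 0 := fun n x hx =>
    (hχd n x).unique <| (hasDerivAt_const x (0 : ℝ)).congr_of_eventuallyEq <| by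
      filter_upwards [Ioi_mem_nhds hx] with y hy using hχ0 n y (le_of_lt hy)
  have hsecond : ∀ n : ℕ,
      (∑' k, ∫⁻ x in Ioi (0:ℝ), ENNReal.ofReal ((χd n x * ∫ y in Ioi x, ψ k y) ^ 2 *
        Real.exp (α * x))) ^ ((1:ℝ)/2) ≤ ENNReal.ofReal (2 * α ^ (-(1:ℝ)/2)) *
          (∑' k, ∫⁻ x in Ioi (0:ℝ), ENNReal.ofReal ((Ici (n : ℝ)).indicator (ψ k) x ^ 2 *
            Real.exp (α * x))) ^ ((1:ℝ)/2) := fun n =>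
    tsum_rpow_half_le_of_le_sq (by positivity) (by rw [mul_pow, hα2]; ring) fun k =>
      lintegral_mul_tail_le hα (hψm k) (hψ0 k) n.cast_nonneg (hχd2 n) (hχd_left n) (hχd_right n)
  refine ⟨fun n => ?_, hsecond, ?_⟩
  · refine tsum_rpow_half_le_of_le_sq (C := 1 ^ 2 * α⁻¹ * ((n : ℝ) + 1 - 0)) (by positivity)
      (by rw [mul_pow, hα2, Real.sq_sqrt (by positivity)]; ring) fun k => ?_
    refine (lintegral_mul_tail_le hα (hψm k) (hψ0 k) le_rfl
      (fun x => abs_le.2 ⟨by linarith [(hχ01 n x).1], (hχ01 n x).2⟩)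
      (fun x h h' => absurd h' h.not_gt) (fun x hx => hχ0 n x hx.le)).trans_eq ?_
    congr 1
    refine setLIntegral_congr_fun measurableSet_Ioi fun x hx => ?_
    have hx' : x ∈ Ici (0 : ℝ) := Ioi_subset_Ici_self hx
    simp only [indicator_of_mem hx']
  · refine tendsto_of_tendsto_of_tendsto_of_le_of_le tendsto_const_nhds ?_
      (fun n => zero_le) hsecond
    have h := (tendsto_tsum_lintegral_indicator_Ici hψm hψfin).ennrpow_const ((1:ℝ)/2)
    rw [ENNReal.zero_rpow_of_pos (by norm_num)] at h
    have h' := ENNReal.Tendsto.const_mul h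
      (Or.inr (ENNReal.ofReal_ne_top (r := 2 * α ^ (-(1:ℝ)/2))))
    rwa [mul_zero] at h'
end

section
/- Let α > 0. Let ψ = (ψ_k)_{k≥1} be nonnegative measurable functions with ‖ψ‖_{ℓ²(L²_α)} < ∞, and let η_k : ℝ → [0,∞) be even, increasing on [0,∞), with η̃(r) := (Σ_k η_k(r)²)^{1/2} < ∞ for every r. Let σ_k : [0,∞) × ℝ → ℝ be C¹ functions with |∂₁σ_k(x,r)| ≤ ψ_k(x) η_k(r) and |∂₂σ_k(x,r)| ≤ η_k(r) for all x, r. Let v : [0,∞) → ℝ be differentiable with ‖v'‖_{L²_α} < ∞ and sup_{x≥0} |v(x)| ≤ M. Then ( Σ_k ∫₀^∞ | ∂₁σ_k(x, v(x)) + ∂₂σ_k(x, v(x)) v'(x) |² e^{αx} dx )^{1/2} ≤ η̃(M) ( ‖ψ‖_{ℓ²(L²_α)} + ‖v'‖_{L²_α} ). (This is the boundedness estimate for the superposition volatility operator σ : H_α → 𝓛²(U, H_α) in Musiela's equation: the left-hand side is the ℓ²(L²_α)-norm of the derivatives d/dx [σ_k(x, v(x))].) -/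
open MeasureTheory Set Filter

lemma ofReal_sq_mul_exp (α x a : ℝ) :
    ENNReal.ofReal (a ^ 2 * Real.exp (α * x)) =
      ENNReal.ofReal (|a| * Real.exp (α * x / 2)) ^ (2:ℝ) := by
  rw [ENNReal.ofReal_rpow_of_nonneg (by positivity) (by norm_num), Real.rpow_two, mul_pow, sq_abs,
    ← Real.exp_nat_mul]
  congr 3
  push_cast
  ring

/-- Minkowski's inequality in the weighted space `L²_α`. -/
lemma lintegral_add_sq_mul_exp_le {μ : Measure ℝ} (α : ℝ) {f g : ℝ → ℝ}
    (hf : AEMeasurable f μ) (hg : AEMeasurable g μ) :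
    (∫⁻ x, ENNReal.ofReal ((|f x| + |g x|) ^ 2 * Real.exp (α * x)) ∂μ) ^ ((1:ℝ)/2) ≤
      (∫⁻ x, ENNReal.ofReal (f x ^ 2 * Real.exp (α * x)) ∂μ) ^ ((1:ℝ)/2) +
        (∫⁻ x, ENNReal.ofReal (g x ^ 2 * Real.exp (α * x)) ∂μ) ^ ((1:ℝ)/2) := by
  have hmeas : ∀ {h : ℝ → ℝ}, AEMeasurable h μ →
      AEMeasurable (fun x => ENNReal.ofReal (|h x| * Real.exp (α * x / 2))) μ := fun hh =>
    ((measurable_norm.comp_aemeasurable hh).mul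
      (by fun_prop : Measurable fun x : ℝ => Real.exp (α * x / 2)).aemeasurable).ennreal_ofReal
  have key := ENNReal.lintegral_Lp_add_le (hmeas hf) (hmeas hg) one_le_two
  simp only [ofReal_sq_mul_exp]
  refine le_trans (le_of_eq ?_) key
  congr 1
  refine lintegral_congr fun x => ?_
  rw [Pi.add_apply, ← ENNReal.ofReal_add (by positivity) (by positivity), ← add_mul,
    abs_of_nonneg (by positivity : 0 ≤ |f x| + |g x|)]

/-- Boundedness estimate for the superposition volatility operator in Musiela's equation:
`( Σ_k ∫₀^∞ |∂₁σ_k(x,v(x)) + ∂₂σ_k(x,v(x)) v'(x)|² e^{αx} dx )^{1/2}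
  ≤ η̃(M) ( ‖ψ‖_{ℓ²(L²_α)} + ‖v'‖_{L²_α} )`,
where `η̃(M) = (Σ_k η_k(M)²)^{1/2}`, `|∂₁σ_k(x,r)| ≤ ψ_k(x) η_k(r)`, `|∂₂σ_k(x,r)| ≤ η_k(r)`,
and `sup_{x ≥ 0} |v(x)| ≤ M`. -/
theorem stmt18 (α : ℝ) (hα : 0 < α)
    (ψ : ℕ → ℝ → ℝ) (hψ0 : ∀ k x, 0 ≤ ψ k x) (hψm : ∀ k, Measurable (ψ k))
    (hψfin : (∑' k, ∫⁻ x in Set.Ioi (0:ℝ),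
        ENNReal.ofReal ((ψ k x) ^ 2 * Real.exp (α * x))) < ⊤)
    (η : ℕ → ℝ → ℝ) (hη0 : ∀ k r, 0 ≤ η k r)
    (hηeven : ∀ k r, η k (-r) = η k r)
    (hηmono : ∀ k, ∀ r₁ r₂ : ℝ, 0 ≤ r₁ → r₁ ≤ r₂ → η k r₁ ≤ η k r₂)
    (hηsum : ∀ r : ℝ, Summable (fun k => (η k r) ^ 2))
    (σ σ₁ σ₂ : ℕ → ℝ → ℝ → ℝ)
    (hσ₁ : ∀ k, ∀ r : ℝ, ∀ x : ℝ, 0 ≤ x → HasDerivAt (fun y => σ k y r) (σ₁ k x r) x)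
    (hσ₂ : ∀ k, ∀ x : ℝ, 0 ≤ x → ∀ r : ℝ, HasDerivAt (fun s => σ k x s) (σ₂ k x r) r)
    (hb1 : ∀ k, ∀ x : ℝ, 0 ≤ x → ∀ r : ℝ, |σ₁ k x r| ≤ ψ k x * η k r)
    (hb2 : ∀ k, ∀ x : ℝ, 0 ≤ x → ∀ r : ℝ, |σ₂ k x r| ≤ η k r)
    (v v' : ℝ → ℝ) (hv : ∀ x : ℝ, 0 ≤ x → HasDerivAt v (v' x) x)
    (hv'fin : (∫⁻ x in Set.Ioi (0:ℝ),
        ENNReal.ofReal ((v' x) ^ 2 * Real.exp (α * x))) < ⊤)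
    (M : ℝ) (hM : ∀ x : ℝ, 0 ≤ x → |v x| ≤ M) :
    (∑' k, ∫⁻ x in Set.Ioi (0:ℝ),
        ENNReal.ofReal ((σ₁ k x (v x) + σ₂ k x (v x) * v' x) ^ 2 *
          Real.exp (α * x))) ^ ((1:ℝ)/2)
      ≤ (∑' k, ENNReal.ofReal ((η k M) ^ 2)) ^ ((1:ℝ)/2) *
          ((∑' k, ∫⁻ x in Set.Ioi (0:ℝ),
              ENNReal.ofReal ((ψ k x) ^ 2 * Real.exp (α * x))) ^ ((1:ℝ)/2)
            + (∫⁻ x in Set.Ioi (0:ℝ),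
                ENNReal.ofReal ((v' x) ^ 2 * Real.exp (α * x))) ^ ((1:ℝ)/2)) := by
  have hvm : AEMeasurable v' (volume.restrict (Ioi (0:ℝ))) := by
    refine (measurable_deriv v).aemeasurable.congr ?_
    filter_upwards [ae_restrict_mem measurableSet_Ioi] with x hx
    exact (hv x (le_of_lt hx)).deriv
  set A := ∑' k, ∫⁻ x in Set.Ioi (0:ℝ), ENNReal.ofReal ((ψ k x) ^ 2 * Real.exp (α * x)) with hA
  set B := ∫⁻ x in Set.Ioi (0:ℝ), ENNReal.ofReal ((v' x) ^ 2 * Real.exp (α * x)) with hB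
  have hη : ∀ k x, 0 ≤ x → η k (v x) ≤ η k M := by
    intro k x hx
    have habs : η k |v x| = η k (v x) := by
      rcases abs_choice (v x) with h | h <;> rw [h]
      exact hηeven k _
    exact habs ▸ hηmono k _ _ (abs_nonneg _) (hM x hx)
  have hterm : ∀ k, ∫⁻ x in Set.Ioi (0:ℝ),
      ENNReal.ofReal ((σ₁ k x (v x) + σ₂ k x (v x) * v' x) ^ 2 * Real.exp (α * x)) ≤
      ENNReal.ofReal ((η k M) ^ 2) * (A ^ ((1:ℝ)/2) + B ^ ((1:ℝ)/2)) ^ (2:ℝ) := by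
    intro k
    calc _ ≤ ∫⁻ x in Set.Ioi (0:ℝ), ENNReal.ofReal ((η k M) ^ 2) *
          ENNReal.ofReal ((|ψ k x| + |v' x|) ^ 2 * Real.exp (α * x)) := by
          refine setLIntegral_mono' measurableSet_Ioi fun x hx => ?_
          have hx0 : 0 ≤ x := le_of_lt hx
          rw [← ENNReal.ofReal_mul (sq_nonneg _), ← mul_assoc, ← mul_pow]
          refine ENNReal.ofReal_le_ofReal
            (mul_le_mul_of_nonneg_right (sq_le_sq' ?_ ?_) (Real.exp_nonneg _))
          all_goals
            have h : |σ₁ k x (v x) + σ₂ k x (v x) * v' x| ≤ η k M * (|ψ k x| + |v' x|) := by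
              calc _ ≤ |σ₁ k x (v x)| + |σ₂ k x (v x)| * |v' x| := by
                    rw [← abs_mul]; exact abs_add_le _ _
                _ ≤ ψ k x * η k M + η k M * |v' x| := by
                    gcongr
                    · exact (hb1 k x hx0 _).trans
                        (mul_le_mul_of_nonneg_left (hη k x hx0) (hψ0 k x))
                    · exact (hb2 k x hx0 _).trans (hη k x hx0)
                _ = _ := by rw [abs_of_nonneg (hψ0 k x)]; ring
          · exact (abs_le.mp h).1
          · exact (abs_le.mp h).2
      _ = ENNReal.ofReal ((η k M) ^ 2) * ∫⁻ x in Set.Ioi (0:ℝ),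
          ENNReal.ofReal ((|ψ k x| + |v' x|) ^ 2 * Real.exp (α * x)) :=
          lintegral_const_mul' _ _ ENNReal.ofReal_ne_top
      _ ≤ _ := by
          gcongr
          rw [← ENNReal.rpow_inv_le_iff two_pos, ← one_div]
          refine (lintegral_add_sq_mul_exp_le α (hψm k).aemeasurable hvm).trans ?_
          gcongr
          exact ENNReal.le_tsum k
  calc _ ≤ ((∑' k, ENNReal.ofReal ((η k M) ^ 2)) *
        (A ^ ((1:ℝ)/2) + B ^ ((1:ℝ)/2)) ^ (2:ℝ)) ^ ((1:ℝ)/2) := by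
        gcongr
        exact (ENNReal.tsum_le_tsum hterm).trans_eq ENNReal.tsum_mul_right
    _ = _ := by
        rw [ENNReal.mul_rpow_of_nonneg _ _ (by norm_num), ← ENNReal.rpow_mul]
        norm_num
end
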